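/- Let α : {0,1}ⁿ → ℂ with Σ_x |α_x|² = 1, and φ_x unit vectors. Fix γ, κ ≥ 0 with γ + κ < 1/2. Define S⁺ = {x : Q⁺(x) ≤ 2^{-(γ+κ)n}} and S^× = {z : Q^×(z) ≤ 2^{-(γ+κ)n}}, where Q⁺ and Q^× are the computational- and Hadamard-basis measurement distributions. Then Q⁺(S⁺) + Q^×(S^×) ≥ 1 − μ(n) for some function μ negligible in n. Moreover, the complements satisfy |complement of S⁺| < 2^{(γ+κ)n} and |complement of S^×| < 2^{(γ+κ)n}. -/

import Mathlib

open scoped BigOperators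

/-- A function is negligible if it is eventually smaller than every inverse polynomial. -/
def Negligible (μ : ℕ → ℝ) : Prop :=
  ∀ c : ℕ, ∃ n₀ : ℕ, ∀ n ≥ n₀, |μ n| ≤ 1 / (n : ℝ) ^ c

/-- The sign `(-1)^{x·z}` where `x·z` is the inner product mod 2 of bit strings. -/
noncomputable def hadSign {n : ℕ} (x z : Fin n → Bool) : ℂ :=
  (-1) ^ (∑ i : Fin n, (if x i && z i then 1 else 0 : ℕ))

/-- Hadamard-basis measurement distribution of the purified state
`ψ = ∑ x, α x • (|x⟩ ⊗ φ x)` (ancilla of dimension `2^n` suffices). -/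
noncomputable def Qtimes {n : ℕ} (α : (Fin n → Bool) → ℂ)
    (φ : (Fin n → Bool) → EuclideanSpace ℂ (Fin n → Bool)) (z : Fin n → Bool) : ℝ :=
  ‖∑ x : Fin n → Bool, ((((Real.sqrt (2 ^ n))⁻¹ : ℝ) : ℂ) * hadSign x z * α x) • φ x‖ ^ 2

theorem hadSign_eq_prod {n : ℕ} (x z : Fin n → Bool) :
    hadSign x z = ∏ i, (if x i && z i then (-1 : ℂ) else 1) := by
  unfold hadSign
  rw [← Finset.prod_pow_eq_pow_sum]
  refine Finset.prod_congr rfl fun i _ => ?_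
  split_ifs <;> simp

theorem norm_hadSign {n : ℕ} (x z : Fin n → Bool) : ‖hadSign x z‖ = 1 := by
  simp [hadSign]

theorem conj_hadSign {n : ℕ} (x z : Fin n → Bool) :
    (starRingEnd ℂ) (hadSign x z) = hadSign x z := by
  simp [hadSign]

theorem sum_hadSign_mul_hadSign {n : ℕ} (x y : Fin n → Bool) :
    ∑ z, hadSign x z * hadSign y z = if x = y then (2 : ℂ) ^ n else 0 := by
  have key : ∑ z, hadSign x z * hadSign y z =
      ∏ i, ∑ b : Bool, (if x i && b then (-1 : ℂ) else 1) * (if y i && b then (-1 : ℂ) else 1) := by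
    rw [Finset.prod_univ_sum, Fintype.piFinset_univ]
    refine Finset.sum_congr rfl fun z _ => ?_
    rw [hadSign_eq_prod, hadSign_eq_prod, Finset.prod_mul_distrib]
  have factor (a c : Bool) :
      ∑ b : Bool, (if a && b then (-1 : ℂ) else 1) * (if c && b then (-1 : ℂ) else 1) =
        if a = c then 2 else 0 := by
    cases a <;> cases c <;> norm_num
  rw [key]
  simp only [factor]
  split_ifs with h
  · subst h; simp
  · obtain ⟨i, hi⟩ := Function.ne_iff.mp h
    exact Finset.prod_eq_zero (Finset.mem_univ i) (if_neg hi)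

/-- The Hadamard transform of a vector-valued function on bit strings. -/
noncomputable def hadTransform {n : ℕ} {E : Type*} [AddCommGroup E] [Module ℂ E]
    (v : (Fin n → Bool) → E) (z : Fin n → Bool) : E :=
  ∑ x, ((((Real.sqrt (2 ^ n))⁻¹ : ℝ) : ℂ) * hadSign x z) • v x

theorem inv_sqrt_two_pow_mul_self (n : ℕ) :
    (Real.sqrt (2 ^ n))⁻¹ * (Real.sqrt (2 ^ n))⁻¹ = ((2 : ℝ) ^ n)⁻¹ := by
  rw [← mul_inv, Real.mul_self_sqrt (by positivity)]

theorem norm_add_sq_le_young {E : Type*} [SeminormedAddCommGroup E] (u w : E)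
    {c : ℝ} (hc : 0 < c) :
    ‖u + w‖ ^ 2 ≤ (1 + c⁻¹) * ‖u‖ ^ 2 + (1 + c) * ‖w‖ ^ 2 := by
  have h1 : ‖u + w‖ ^ 2 ≤ (‖u‖ + ‖w‖) ^ 2 := by gcongr; exact norm_add_le u w
  have h2 : 0 ≤ c⁻¹ * (‖u‖ - c * ‖w‖) ^ 2 := by positivity
  have h3 : c⁻¹ * (‖u‖ - c * ‖w‖) ^ 2 = c⁻¹ * ‖u‖ ^ 2 - 2 * ‖u‖ * ‖w‖ + c * ‖w‖ ^ 2 := by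
    field_simp
    ring
  nlinarith

section HadTransform

variable {n : ℕ} {E : Type*} [NormedAddCommGroup E] [InnerProductSpace ℂ E]

theorem hadTransform_add (v w : (Fin n → Bool) → E) (z : Fin n → Bool) :
    hadTransform (v + w) z = hadTransform v z + hadTransform w z := by
  simp [hadTransform, Finset.sum_add_distrib]

theorem sum_norm_sq_hadTransform (v : (Fin n → Bool) → E) :
    ∑ z, ‖hadTransform v z‖ ^ 2 = ∑ x, ‖v x‖ ^ 2 := by
  have hs : (((Real.sqrt (2 ^ n))⁻¹ : ℝ) : ℂ) * (((Real.sqrt (2 ^ n))⁻¹ : ℝ) : ℂ) * 2 ^ n = 1 := by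
    rw [← Complex.ofReal_mul, inv_sqrt_two_pow_mul_self]
    push_cast
    exact inv_mul_cancel₀ (pow_ne_zero n two_ne_zero)
  have expand (z : Fin n → Bool) : inner ℂ (hadTransform v z) (hadTransform v z) =
      ∑ x, ∑ y, (((Real.sqrt (2 ^ n))⁻¹ : ℝ) : ℂ) * (((Real.sqrt (2 ^ n))⁻¹ : ℝ) : ℂ) *
        inner ℂ (v x) (v y) * (hadSign x z * hadSign y z) := by
    rw [hadTransform, sum_inner]
    refine Finset.sum_congr rfl fun x _ => ?_
    rw [inner_sum]
    refine Finset.sum_congr rfl fun y _ => ?_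
    rw [inner_smul_left, inner_smul_right, map_mul, conj_hadSign, Complex.conj_ofReal]
    ring
  have main : ∑ z, inner ℂ (hadTransform v z) (hadTransform v z) = ∑ x, inner ℂ (v x) (v x) := by
    simp only [expand]
    rw [Finset.sum_comm]
    refine Finset.sum_congr rfl fun x _ => ?_
    rw [Finset.sum_comm]
    simp only [← Finset.mul_sum, sum_hadSign_mul_hadSign, mul_ite, mul_zero,
      Finset.sum_ite_eq, Finset.mem_univ, if_true]
    linear_combination (inner ℂ (v x) (v x)) * hs
  simp only [inner_self_eq_norm_sq_to_K] at main
  exact_mod_cast main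

theorem norm_sq_hadTransform_le (v : (Fin n → Bool) → E) (L : Finset (Fin n → Bool))
    (hv : ∀ x ∉ L, v x = 0) (z : Fin n → Bool) :
    ‖hadTransform v z‖ ^ 2 ≤ ((2 : ℝ) ^ n)⁻¹ * (L.card * ∑ x, ‖v x‖ ^ 2) := by
  have hsum : hadTransform v z =
      ∑ x ∈ L, ((((Real.sqrt (2 ^ n))⁻¹ : ℝ) : ℂ) * hadSign x z) • v x := by
    refine (Finset.sum_subset (Finset.subset_univ L) fun x _ hx => ?_).symm
    rw [hv x hx, smul_zero]
  have hnorm : ‖hadTransform v z‖ ≤ (Real.sqrt (2 ^ n))⁻¹ * ∑ x ∈ L, ‖v x‖ := by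
    rw [hsum, Finset.mul_sum]
    refine norm_sum_le_of_le _ fun x _ => ?_
    rw [norm_smul, norm_mul, norm_hadSign, mul_one, Complex.norm_real, Real.norm_of_nonneg]
    positivity
  calc ‖hadTransform v z‖ ^ 2 ≤ ((Real.sqrt (2 ^ n))⁻¹ * ∑ x ∈ L, ‖v x‖) ^ 2 := by gcongr
    _ = ((2 : ℝ) ^ n)⁻¹ * (∑ x ∈ L, ‖v x‖) ^ 2 := by
      rw [mul_pow, sq (Real.sqrt _)⁻¹, inv_sqrt_two_pow_mul_self]
    _ ≤ ((2 : ℝ) ^ n)⁻¹ * (L.card * ∑ x, ‖v x‖ ^ 2) := by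
      gcongr
      refine sq_sum_le_card_mul_sum_sq.trans ?_
      gcongr
      exact Finset.subset_univ L

/-- Uncertainty relation: a unit vector cannot have most of its mass on small sets in both the
computational and the Hadamard basis. -/
theorem sum_norm_sq_add_sum_norm_sq_hadTransform_le (v : (Fin n → Bool) → E)
    (hv : ∑ x, ‖v x‖ ^ 2 = 1) (L M : Finset (Fin n → Bool)) {c : ℝ} (hc : 0 < c)
    (hLM : (L.card : ℝ) * M.card ≤ c ^ 2 * 2 ^ n) :
    ∑ x ∈ L, ‖v x‖ ^ 2 + ∑ z ∈ M, ‖hadTransform v z‖ ^ 2 ≤ 1 + c + c ^ 2 := by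
  set a : (Fin n → Bool) → E := fun x => if x ∈ L then v x else 0 with ha
  set b : (Fin n → Bool) → E := fun x => if x ∈ L then 0 else v x with hb
  have hab : v = a + b := by
    funext x
    by_cases hx : x ∈ L <;> simp [ha, hb, hx]
  set p := ∑ x ∈ L, ‖v x‖ ^ 2 with hp
  have hap : ∑ x, ‖a x‖ ^ 2 = p := by
    rw [hp, ← Finset.sum_subset (Finset.subset_univ L)]
    · exact Finset.sum_congr rfl fun x hx => by simp [ha, hx]
    · intro x _ hx
      simp [ha, hx]
  have hbp : ∑ x, ‖b x‖ ^ 2 = 1 - p := by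
    rw [← hap, ← hv, ← Finset.sum_sub_distrib]
    refine Finset.sum_congr rfl fun x _ => ?_
    by_cases hx : x ∈ L <;> simp [ha, hb, hx]
  have hp0 : 0 ≤ p := by positivity
  have hp1 : 0 ≤ 1 - p := hbp ▸ by positivity
  have hA : ∑ z ∈ M, ‖hadTransform a z‖ ^ 2 ≤ c ^ 2 * p := by
    calc ∑ z ∈ M, ‖hadTransform a z‖ ^ 2
        ≤ ∑ _z ∈ M, ((2 : ℝ) ^ n)⁻¹ * (L.card * p) :=
          Finset.sum_le_sum fun z _ => hap ▸
            norm_sq_hadTransform_le a L (fun x hx => by simp [ha, hx]) z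
      _ = ((2 : ℝ) ^ n)⁻¹ * (L.card * M.card) * p := by
          rw [Finset.sum_const, nsmul_eq_mul]
          ring
      _ ≤ ((2 : ℝ) ^ n)⁻¹ * (c ^ 2 * 2 ^ n) * p := by gcongr
      _ = c ^ 2 * p := by field_simp
  have hB : ∑ z ∈ M, ‖hadTransform b z‖ ^ 2 ≤ 1 - p := by
    rw [← hbp, ← sum_norm_sq_hadTransform b]
    exact Finset.sum_le_sum_of_subset_of_nonneg (Finset.subset_univ M) fun _ _ _ => by positivity
  have hM : ∑ z ∈ M, ‖hadTransform v z‖ ^ 2 ≤ (1 + c⁻¹) * (c ^ 2 * p) + (1 + c) * (1 - p) := by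
    calc ∑ z ∈ M, ‖hadTransform v z‖ ^ 2
        ≤ ∑ z ∈ M, ((1 + c⁻¹) * ‖hadTransform a z‖ ^ 2 + (1 + c) * ‖hadTransform b z‖ ^ 2) :=
          Finset.sum_le_sum fun z _ => by
            rw [hab, hadTransform_add]
            exact norm_add_sq_le_young _ _ hc
      _ = (1 + c⁻¹) * ∑ z ∈ M, ‖hadTransform a z‖ ^ 2
            + (1 + c) * ∑ z ∈ M, ‖hadTransform b z‖ ^ 2 := by
          rw [Finset.sum_add_distrib, Finset.mul_sum, Finset.mul_sum]
      _ ≤ _ := by gcongr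
  have hcc : (1 + c⁻¹) * (c ^ 2 * p) = c ^ 2 * p + c * p := by
    field_simp
  nlinarith [mul_nonneg (sq_nonneg c) hp1]

end HadTransform

theorem Qtimes_eq_norm_sq_hadTransform {n : ℕ} (α : (Fin n → Bool) → ℂ)
    (φ : (Fin n → Bool) → EuclideanSpace ℂ (Fin n → Bool)) (z : Fin n → Bool) :
    Qtimes α φ z = ‖hadTransform (fun x => α x • φ x) z‖ ^ 2 := by
  simp only [Qtimes, hadTransform, smul_smul]

open Classical in
theorem card_filter_not_le_lt_inv {ι : Type*} [Fintype ι] (f : ι → ℝ) (hf : ∀ i, 0 ≤ f i)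
    (hsum : ∑ i, f i = 1) {t : ℝ} (ht : 0 < t) :
    ((Finset.univ.filter fun i => ¬ f i ≤ t).card : ℝ) < t⁻¹ := by
  rcases (Finset.univ.filter fun i => ¬ f i ≤ t).eq_empty_or_nonempty with h | h
  · rw [h]
    simpa using ht
  · have h1 : ((Finset.univ.filter fun i => ¬ f i ≤ t).card : ℝ) * t <
        ∑ i ∈ Finset.univ.filter fun i => ¬ f i ≤ t, f i := by
      rw [← nsmul_eq_mul, ← Finset.sum_const]
      exact Finset.sum_lt_sum_of_nonempty h fun i hi => not_le.mp (Finset.mem_filter.mp hi).2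
    have h2 : ∑ i ∈ Finset.univ.filter fun i => ¬ f i ≤ t, f i ≤ 1 :=
      hsum ▸ Finset.sum_le_sum_of_subset_of_nonneg (Finset.subset_univ _) fun i _ _ => hf i
    rw [← one_div, lt_div_iff₀ ht]
    exact h1.trans_le h2

theorem negligible_const_mul_pow (a : ℝ) {r : ℝ} (hr : |r| < 1) :
    Negligible fun n => a * r ^ n := by
  intro c
  have h := ((tendsto_pow_const_mul_const_pow_of_abs_lt_one c hr).const_mul a).abs
  rw [mul_zero, abs_zero] at h
  obtain ⟨n₀, hn₀⟩ := Filter.eventually_atTop.mp (h.eventually_le_const one_pos)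
  refine ⟨max n₀ 1, fun n hn => ?_⟩
  have hpos : (0 : ℝ) < (n : ℝ) ^ c := by
    have : 0 < n := (le_max_right n₀ 1).trans hn
    positivity
  rw [le_div_iff₀ hpos, ← abs_of_pos hpos, ← abs_mul]
  refine le_of_eq_of_le (congrArg _ ?_) (hn₀ n ((le_max_left _ _).trans hn))
  ring

open Classical in
/-- Corollary 3 of the paper: for `γ, κ ≥ 0` with `γ + κ < 1/2`, the sets
`S⁺ = {x : Q⁺(x) ≤ 2^{-(γ+κ)n}}` and `S^× = {z : Q^×(z) ≤ 2^{-(γ+κ)n}}`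
of small-probability strings satisfy `Q⁺(S⁺) + Q^×(S^×) ≥ 1 − μ(n)` for some negligible
`μ`; moreover their complements have fewer than `2^{(γ+κ)n}` elements. -/
theorem small_sets_carry_the_mass (γ κ : ℝ) (hγ : 0 ≤ γ) (hκ : 0 ≤ κ)
    (hlt : γ + κ < 1 / 2) :
    ∃ μ : ℕ → ℝ, Negligible μ ∧
      ∀ (n : ℕ) (α : (Fin n → Bool) → ℂ)
        (φ : (Fin n → Bool) → EuclideanSpace ℂ (Fin n → Bool)),
        (∀ x, ‖φ x‖ = 1) → (∑ x : Fin n → Bool, ‖α x‖ ^ 2 = 1) →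
        (∑ x ∈ Finset.univ.filter
              (fun x : Fin n → Bool => ‖α x‖ ^ 2 ≤ (2 : ℝ) ^ (-((γ + κ) * (n : ℝ)))),
            ‖α x‖ ^ 2)
          + (∑ z ∈ Finset.univ.filter
              (fun z : Fin n → Bool => Qtimes α φ z ≤ (2 : ℝ) ^ (-((γ + κ) * (n : ℝ)))),
            Qtimes α φ z) ≥ 1 - μ n
        ∧ ((Finset.univ.filter (fun x : Fin n → Bool =>
              ¬ (‖α x‖ ^ 2 ≤ (2 : ℝ) ^ (-((γ + κ) * (n : ℝ)))))).card : ℝ) <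
            (2 : ℝ) ^ ((γ + κ) * (n : ℝ))
        ∧ ((Finset.univ.filter (fun z : Fin n → Bool =>
              ¬ (Qtimes α φ z ≤ (2 : ℝ) ^ (-((γ + κ) * (n : ℝ)))))).card : ℝ) <
            (2 : ℝ) ^ ((γ + κ) * (n : ℝ)) := by
  have hr0 : (0 : ℝ) < (2 : ℝ) ^ (-(1 / 2 - (γ + κ))) := by positivity
  have hr1 : (2 : ℝ) ^ (-(1 / 2 - (γ + κ))) < 1 :=
    Real.rpow_lt_one_of_one_lt_of_neg one_lt_two (by linarith)
  refine ⟨fun n => 2 * ((2 : ℝ) ^ (-(1 / 2 - (γ + κ)))) ^ n,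
    negligible_const_mul_pow 2 (by rwa [abs_of_pos hr0]), fun n α φ hφ hα => ?_⟩
  set v : (Fin n → Bool) → EuclideanSpace ℂ (Fin n → Bool) := fun x => α x • φ x
  have hv (x : Fin n → Bool) : ‖v x‖ ^ 2 = ‖α x‖ ^ 2 := by simp [v, norm_smul, hφ]
  simp only [Qtimes_eq_norm_sq_hadTransform, ← hv] at hα ⊢
  change ∑ x, ‖v x‖ ^ 2 = 1 at hα
  have hβ : ∑ z, ‖hadTransform v z‖ ^ 2 = 1 := (sum_norm_sq_hadTransform v).trans hα
  have ht : (0 : ℝ) < (2 : ℝ) ^ (-((γ + κ) * (n : ℝ))) := by positivity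
  have hinv : ((2 : ℝ) ^ (-((γ + κ) * (n : ℝ))))⁻¹ = (2 : ℝ) ^ ((γ + κ) * (n : ℝ)) := by
    rw [Real.rpow_neg zero_le_two, inv_inv]
  have hL := card_filter_not_le_lt_inv (fun x => ‖v x‖ ^ 2) (fun _ => by positivity) hα ht
  have hM := card_filter_not_le_lt_inv (fun z => ‖hadTransform v z‖ ^ 2)
    (fun _ => by positivity) hβ ht
  rw [hinv] at hL hM
  refine ⟨?_, hL, hM⟩
  set c : ℝ := ((2 : ℝ) ^ (-(1 / 2 - (γ + κ)))) ^ n with hc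
  have hc0 : 0 < c := by positivity
  have hc1 : c ≤ 1 := pow_le_one₀ hr0.le hr1.le
  have hcsq : c ^ 2 * 2 ^ n = (2 : ℝ) ^ ((γ + κ) * (n : ℝ)) * (2 : ℝ) ^ ((γ + κ) * (n : ℝ)) := by
    rw [hc, ← pow_mul, ← Real.rpow_natCast, ← Real.rpow_natCast 2 n,
      ← Real.rpow_mul zero_le_two, ← Real.rpow_add two_pos, ← Real.rpow_add two_pos]
    congr 1
    push_cast
    ring
  have huncertainty := sum_norm_sq_add_sum_norm_sq_hadTransform_le v hα _ _ hc0
    ((mul_le_mul hL.le hM.le (by positivity) (by positivity)).trans hcsq.ge)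
  have hsplit₁ := Finset.sum_filter_add_sum_filter_not Finset.univ
    (fun x => ‖v x‖ ^ 2 ≤ (2 : ℝ) ^ (-((γ + κ) * (n : ℝ)))) (fun x => ‖v x‖ ^ 2)
  have hsplit₂ := Finset.sum_filter_add_sum_filter_not Finset.univ
    (fun z => ‖hadTransform v z‖ ^ 2 ≤ (2 : ℝ) ^ (-((γ + κ) * (n : ℝ))))
    (fun z => ‖hadTransform v z‖ ^ 2)
  rw [hα] at hsplit₁
  rw [hβ] at hsplit₂
  have hcc : c ^ 2 ≤ c := by nlinarith
  linarith
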